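/- arXiv:1301.1558 — 2 statements merged into one kernel-verified Lean document; each statement's English description precedes it below -/
import Mathlib

section
/- Let X = (y,U,ν,r) ∈ F. Then the pushforward measure y_#(r dξ) of the periodic measure r(ξ) dξ under y is absolutely continuous with respect to Lebesgue measure, and the triple (u,ρ,μ) defined by u(x) = U(ξ) for any ξ such that x = y(ξ) (this is well defined), μ = y_#(ν dξ), and ρ dx = y_#(r dξ), belongs to D; thus the map M : F → D sending X to (u,ρ,μ) is well defined. -/
open MeasureTheory Real Set Filter Function

noncomputable section

/-- Lagrangian variables for the periodic 2CH system: `y` is the characteristic,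
`U` the Lagrangian velocity, `ν` the Lagrangian energy density, `r` the Lagrangian
density; `yξ` and `Uξ` are the spatial (ξ) derivatives of `y` and `U`. -/
structure LagVar where
  y : ℝ → ℝ
  U : ℝ → ℝ
  ν : ℝ → ℝ
  r : ℝ → ℝ
  yξ : ℝ → ℝ
  Uξ : ℝ → ℝ

/-- The `L^∞([0,1])` norm. -/
def supNorm01 (f : ℝ → ℝ) : ℝ := sSup ((fun x => |f x|) '' Set.Icc (0:ℝ) 1)

/-- The `L^1([0,1])` norm. -/
def L1norm01 (f : ℝ → ℝ) : ℝ := ∫ x in (0:ℝ)..1, |f x|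

/-- The `W^{1,1}_per` norm of a function `f` with (a.e.) derivative `f'`. -/
def W11norm (f f' : ℝ → ℝ) : ℝ := supNorm01 f + L1norm01 f'

/-- The `W^{1,1}_per` norm, using `deriv`. -/
def W11normD (f : ℝ → ℝ) : ℝ := supNorm01 f + L1norm01 (deriv f)

/-- Membership in the Banach space `E`: `y − id`, `U` belong to `W^{1,1}_per`
(absolutely continuous with the given derivatives `yξ`, `Uξ`) and `ν`, `r ∈ L^1_per`. -/
def InE (X : LagVar) : Prop :=
  Continuous X.y ∧ Continuous X.U ∧
  (∀ ξ, X.y (ξ + 1) = X.y ξ + 1) ∧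
  (∀ ξ, X.U (ξ + 1) = X.U ξ) ∧ (∀ ξ, X.ν (ξ + 1) = X.ν ξ) ∧
  (∀ ξ, X.r (ξ + 1) = X.r ξ) ∧ (∀ ξ, X.yξ (ξ + 1) = X.yξ ξ) ∧
  (∀ ξ, X.Uξ (ξ + 1) = X.Uξ ξ) ∧
  (∀ a b : ℝ, X.y b - X.y a = ∫ ξ in a..b, X.yξ ξ) ∧
  (∀ a b : ℝ, X.U b - X.U a = ∫ ξ in a..b, X.Uξ ξ) ∧
  IntervalIntegrable X.yξ volume 0 1 ∧ IntervalIntegrable X.Uξ volume 0 1 ∧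
  IntervalIntegrable X.ν volume 0 1 ∧ IntervalIntegrable X.r volume 0 1

/-- The `E`-norm of the difference of two elements of `E`:
`‖X − X'‖_E = ‖y − y'‖_{W^{1,1}_per} + ‖U − U'‖_{W^{1,1}_per} + ‖ν − ν'‖_{L^1_per} + ‖r − r'‖_{L^1_per}`. -/
def Edist (X X' : LagVar) : ℝ :=
  W11norm (fun ξ => X.y ξ - X'.y ξ) (fun ξ => X.yξ ξ - X'.yξ ξ)
    + W11norm (fun ξ => X.U ξ - X'.U ξ) (fun ξ => X.Uξ ξ - X'.Uξ ξ)
    + L1norm01 (fun ξ => X.ν ξ - X'.ν ξ)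
    + L1norm01 (fun ξ => X.r ξ - X'.r ξ)

/-- The bounded set `B_M ⊂ E`. -/
def InBM (M : ℝ) (X : LagVar) : Prop :=
  W11norm X.U X.Uξ + L1norm01 X.yξ + L1norm01 X.ν ≤ M

/-- The map `P` of the Lagrangian 2CH system. -/
def Pmap (X : LagVar) (ξ : ℝ) : ℝ :=
  (1 / (2 * (Real.exp 1 - 1))) *
      ∫ η in (0:ℝ)..1, Real.cosh (X.y ξ - X.y η) * ((X.U η)^2 * X.yξ η + X.ν η)
    + (1/4) * ∫ η in (0:ℝ)..1,
        Real.exp (-(Real.sign (ξ - η)) * (X.y ξ - X.y η)) * ((X.U η)^2 * X.yξ η + X.ν η)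

/-- The map `Q` of the Lagrangian 2CH system. -/
def Qmap (X : LagVar) (ξ : ℝ) : ℝ :=
  (1 / (2 * (Real.exp 1 - 1))) *
      ∫ η in (0:ℝ)..1, Real.sinh (X.y ξ - X.y η) * ((X.U η)^2 * X.yξ η + X.ν η)
    - (1/4) * ∫ η in (0:ℝ)..1,
        Real.sign (ξ - η) * Real.exp (-(Real.sign (ξ - η)) * (X.y ξ - X.y η)) *
          ((X.U η)^2 * X.yξ η + X.ν η)

/-- Membership in the set `F ⊂ E`. -/
def InF (X : LagVar) : Prop :=
  InE X ∧
  (∃ C : ℝ, ∀ᵐ ξ ∂(volume : Measure ℝ),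
      |X.yξ ξ| ≤ C ∧ |X.Uξ ξ| ≤ C ∧ |X.ν ξ| ≤ C ∧ |X.r ξ| ≤ C) ∧
  (∀ᵐ ξ ∂(volume : Measure ℝ), 0 ≤ X.yξ ξ) ∧
  (∀ᵐ ξ ∂(volume : Measure ℝ), 0 ≤ X.ν ξ) ∧
  (∃ c : ℝ, 0 < c ∧ ∀ᵐ ξ ∂(volume : Measure ℝ), c ≤ X.yξ ξ + X.ν ξ) ∧
  (∀ᵐ ξ ∂(volume : Measure ℝ),
      X.yξ ξ * X.ν ξ = (X.yξ ξ)^2 * (X.U ξ)^2 + (X.Uξ ξ)^2 + (X.r ξ)^2)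

/-- `X : ℝ → LagVar` is a (global, for `t ≥ 0`) solution of the Lagrangian 2CH system
`y_t = U`, `U_t = −Q`, `ν_t = −2QUy_ξ + (3U² − 2P)U_ξ`, `r_t = 0`. -/
def IsLagSolution (X : ℝ → LagVar) : Prop :=
  (∀ t, 0 ≤ t → InE (X t)) ∧
  (∀ ξ, ∀ t, 0 ≤ t →
    HasDerivWithinAt (fun s => (X s).y ξ) ((X t).U ξ) (Set.Ici 0) t) ∧
  (∀ ξ, ∀ t, 0 ≤ t →
    HasDerivWithinAt (fun s => (X s).U ξ) (-(Qmap (X t) ξ)) (Set.Ici 0) t) ∧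
  (∀ ξ, ∀ t, 0 ≤ t →
    HasDerivWithinAt (fun s => (X s).ν ξ)
      (-2 * Qmap (X t) ξ * (X t).U ξ * (X t).yξ ξ
        + (3 * ((X t).U ξ)^2 - 2 * Pmap (X t) ξ) * (X t).Uξ ξ) (Set.Ici 0) t) ∧
  (∀ ξ, ∀ t, 0 ≤ t →
    HasDerivWithinAt (fun s => (X s).r ξ) 0 (Set.Ici 0) t)

/-- A relabeling function `f`, together with its inverse and its derivative. -/
structure Relabel where
  f : ℝ → ℝ
  finv : ℝ → ℝ
  fξ : ℝ → ℝ

/-- Membership in the relabeling group `G`. -/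
def InG (g : Relabel) : Prop :=
  Function.LeftInverse g.finv g.f ∧ Function.RightInverse g.finv g.f ∧
  (∀ ξ, g.f (ξ + 1) = g.f ξ + 1) ∧
  (∃ K : NNReal, LipschitzWith K g.f) ∧
  (∃ K : NNReal, LipschitzWith K g.finv) ∧
  (∀ a b : ℝ, g.f b - g.f a = ∫ ξ in a..b, g.fξ ξ)

/-- The action `X • f = (y∘f, U∘f, (ν∘f)f_ξ, (r∘f)f_ξ)` of a relabeling function on `F`. -/
def act (X : LagVar) (g : Relabel) : LagVar where
  y := fun ξ => X.y (g.f ξ)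
  U := fun ξ => X.U (g.f ξ)
  ν := fun ξ => X.ν (g.f ξ) * g.fξ ξ
  r := fun ξ => X.r (g.f ξ) * g.fξ ξ
  yξ := fun ξ => X.yξ (g.f ξ) * g.fξ ξ
  Uξ := fun ξ => X.Uξ (g.f ξ) * g.fξ ξ

/-- The inverse of a relabeling function. -/
def Relabel.inverse (g : Relabel) : Relabel := ⟨g.finv, g.f, deriv g.finv⟩

/-- `F₀ = {X ∈ F : y_ξ + ν = 1 + h a.e.}`, where `h = ∫₀¹ ν`. -/
def InF0 (X : LagVar) : Prop :=
  InF X ∧ ∀ᵐ ξ ∂(volume : Measure ℝ), X.yξ ξ + X.ν ξ = 1 + ∫ η in (0:ℝ)..1, X.ν η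

/-- `H = {X ∈ F₀ : ∫₀¹ y dξ = 0}`. -/
def InH (X : LagVar) : Prop := InF0 X ∧ (∫ ξ in (0:ℝ)..1, X.y ξ) = 0

/-- `H^M = {X ∈ H : h ≤ M}`. -/
def InHM (M : ℝ) (X : LagVar) : Prop := InH X ∧ (∫ ξ in (0:ℝ)..1, X.ν ξ) ≤ M

/-- The relabeling function `f(ξ) = (1/(1+h))(y(ξ) + ∫₀^ξ ν)` associated with `X ∈ F`. -/
def relabelOf (X : LagVar) : Relabel :=
  ⟨fun ξ => (1 / (1 + ∫ η in (0:ℝ)..1, X.ν η)) * (X.y ξ + ∫ η in (0:ℝ)..ξ, X.ν η),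
   Function.invFun
     (fun ξ => (1 / (1 + ∫ η in (0:ℝ)..1, X.ν η)) * (X.y ξ + ∫ η in (0:ℝ)..ξ, X.ν η)),
   deriv (fun ξ => (1 / (1 + ∫ η in (0:ℝ)..1, X.ν η)) * (X.y ξ + ∫ η in (0:ℝ)..ξ, X.ν η))⟩

/-- The projection `Π₁ : F → F₀`, `Π₁(X) = X • f⁻¹`. -/
def Pi1 (X : LagVar) : LagVar := act X (relabelOf X).inverse

/-- The shift `(Π₂ X)(ξ) = X(ξ − a)`. -/
def shiftX (X : LagVar) (a : ℝ) : LagVar :=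
  ⟨fun ξ => X.y (ξ - a), fun ξ => X.U (ξ - a), fun ξ => X.ν (ξ - a), fun ξ => X.r (ξ - a),
   fun ξ => X.yξ (ξ - a), fun ξ => X.Uξ (ξ - a)⟩

/-- The projection `Π = Π₂ ∘ Π₁ : F → H`. -/
def PiMap (X : LagVar) : LagVar := shiftX (Pi1 X) (∫ ξ in (0:ℝ)..1, (Pi1 X).y ξ)

/-- Membership in the set `D` of Eulerian data: `u ∈ H^1_per` (with derivative `ux`),
`ρ ∈ L^2_per`, and `μ` a positive periodic Radon measure with
`μ_ac = (u² + u_x² + ρ²) dx`. -/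
def InD (u ux ρ : ℝ → ℝ) (μ : Measure ℝ) : Prop :=
  Continuous u ∧
  (∀ x, u (x + 1) = u x) ∧ (∀ x, ux (x + 1) = ux x) ∧ (∀ x, ρ (x + 1) = ρ x) ∧
  (∀ a b : ℝ, u b - u a = ∫ x in a..b, ux x) ∧
  IntervalIntegrable (fun x => (ux x)^2) volume 0 1 ∧
  IntervalIntegrable (fun x => (ρ x)^2) volume 0 1 ∧
  IsLocallyFiniteMeasure μ ∧
  μ.map (fun x => x + 1) = μ ∧
  (∃ μs : Measure ℝ, μs.MutuallySingular volume ∧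
    μ = volume.withDensity (fun x => ENNReal.ofReal ((u x)^2 + (ux x)^2 + (ρ x)^2)) + μs)

/-- `F_μ(x) = μ([0,x))` for `x ≥ 0` and `−μ([x,0))` for `x < 0`. -/
def Fmu (μ : Measure ℝ) (x : ℝ) : ℝ :=
  if 0 ≤ x then (μ (Set.Ico 0 x)).toReal else -((μ (Set.Ico x 0)).toReal)

/-- The map `L̃ : D → F` from Eulerian to Lagrangian coordinates. -/
def Ltilde (u ρ : ℝ → ℝ) (μ : Measure ℝ) : LagVar :=
  let h : ℝ := (μ (Set.Ico (0:ℝ) 1)).toReal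
  let y : ℝ → ℝ := fun ξ => sSup {x : ℝ | Fmu μ x + x < (1 + h) * ξ}
  { y := y
    U := fun ξ => u (y ξ)
    ν := fun ξ => (1 + h) - deriv y ξ
    r := fun ξ => ρ (y ξ) * deriv y ξ
    yξ := deriv y
    Uξ := deriv (fun ξ => u (y ξ)) }

/-- The relation `(u,ρ,μ) = M(X)`: `u(x) = U(ξ)` for `x = y(ξ)`, `μ = y_#(ν dξ)` and
`ρ dx = y_#(r dξ)` (so that in particular `y_#(r dξ)` is absolutely continuous). -/
def MRel (X : LagVar) (u ρ : ℝ → ℝ) (μ : Measure ℝ) : Prop :=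
  (∀ ξ, u (X.y ξ) = X.U ξ) ∧
  μ = Measure.map X.y (volume.withDensity fun ξ => ENNReal.ofReal (X.ν ξ)) ∧
  (∀ φ : ℝ → ℝ, Continuous φ → HasCompactSupport φ →
    (∫ x, φ x * ρ x) = ∫ ξ, φ (X.y ξ) * X.r ξ)

/-- `J(X_α,X_β) = inf_{f,g ∈ G} ‖X_α • f − X_β • g‖_E`. -/
def Jfun (Xa Xb : LagVar) : ℝ :=
  sInf {v : ℝ | ∃ f g : Relabel, InG f ∧ InG g ∧ v = Edist (act Xa f) (act Xb g)}

/-- `d(X_α,X_β) = inf Σ J(X_{n−1},X_n)` over finite sequences in `F` joining `X_α` to `X_β`. -/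
def dfun (Xa Xb : LagVar) : ℝ :=
  sInf {v : ℝ | ∃ N : ℕ, 1 ≤ N ∧ ∃ Z : ℕ → LagVar,
    (∀ n, n ≤ N → InF (Z n)) ∧ Z 0 = Xa ∧ Z N = Xb ∧
    v = ∑ n ∈ Finset.range N, Jfun (Z n) (Z (n+1))}

/-- `d_M(X_α,X_β) = inf Σ J(X_{n−1},X_n)` over finite sequences in `H^M` joining `X_α` to `X_β`. -/
def dM (M : ℝ) (Xa Xb : LagVar) : ℝ :=
  sInf {v : ℝ | ∃ N : ℕ, 1 ≤ N ∧ ∃ Z : ℕ → LagVar,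
    (∀ n, n ≤ N → InHM M (Z n)) ∧ Z 0 = Xa ∧ Z N = Xb ∧
    v = ∑ n ∈ Finset.range N, Jfun (Z n) (Z (n+1))}

/-- The metric `d_{D^M}` on Eulerian sets of bounded energy. -/
def dD (M : ℝ) (u ρ : ℝ → ℝ) (μ : Measure ℝ) (u' ρ' : ℝ → ℝ) (μ' : Measure ℝ) : ℝ :=
  dM M (PiMap (Ltilde u ρ μ)) (PiMap (Ltilde u' ρ' μ'))

/-- `D^M = {(u,ρ,μ) ∈ D : μ([0,1)) ≤ M}`. -/
def InDM (Mc : ℝ) (u ux ρ : ℝ → ℝ) (μ : Measure ℝ) : Prop :=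
  InD u ux ρ μ ∧ (μ (Set.Ico (0:ℝ) 1)).toReal ≤ Mc

/-- The support of a measure on `ℝ`. -/
def msupport (μ : Measure ℝ) : Set ℝ :=
  {x : ℝ | ∀ ε : ℝ, 0 < ε → 0 < μ (Set.Ioo (x - ε) (x + ε))}

/-- The Eulerian function `P(t,·)` computed from `u(t,·)` and `μ(t)`. -/
def Peul (u : ℝ → ℝ) (μ : Measure ℝ) (x : ℝ) : ℝ :=
  (1 / (2 * (Real.exp 1 - 1))) * ∫ z in (0:ℝ)..1, Real.cosh (x - z) * (u z)^2
    + (1 / (2 * (Real.exp 1 - 1))) * ∫ z in Set.Ico (0:ℝ) 1, Real.cosh (x - z) ∂μ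
    + (1/4) * ∫ z in (0:ℝ)..1, Real.exp (-|x - z|) * (u z)^2
    + (1/4) * ∫ z in Set.Ico (0:ℝ) 1, Real.exp (-|x - z|) ∂μ

/-- Partial derivative in time. -/
def partialT (u : ℝ → ℝ → ℝ) (t x : ℝ) : ℝ := deriv (fun s => u s x) t

/-- Partial derivative in space. -/
def partialX (u : ℝ → ℝ → ℝ) (t x : ℝ) : ℝ := deriv (fun z => u t z) x

/-- `(u,ρ)` is a classical solution, for `t > 0`, of the 2CH system with parameters `κ, η`. -/
def Is2CH (κ η : ℝ) (u ρ : ℝ → ℝ → ℝ) : Prop :=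
  ∀ t, 0 < t → ∀ x,
    partialT u t x - partialT (partialX (partialX u)) t x + κ * partialX u t x
        + 3 * u t x * partialX u t x
        - 2 * partialX u t x * partialX (partialX u) t x
        - u t x * partialX (partialX (partialX u)) t x
        + η * ρ t x * partialX ρ t x = 0 ∧
    partialT ρ t x + partialX (fun s z => u s z * ρ s z) t x = 0

/-- Spatial periodicity (period 1). -/
def SpacePeriodic (φ : ℝ → ℝ → ℝ) : Prop := ∀ t x, φ t (x + 1) = φ t x

/-- Spatially periodic test functions, smooth and compactly supported in time `[0,∞)`. -/
def TestFn (φ : ℝ → ℝ → ℝ) : Prop :=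
  ContDiff ℝ (⊤ : ℕ∞) (Function.uncurry φ) ∧ SpacePeriodic φ ∧
  ∃ T : ℝ, ∀ t, T ≤ t → ∀ x, φ t x = 0

/-- Test functions as above, vanishing also near `t = 0` (support in `(0,∞)`). -/
def TestFn0 (φ : ℝ → ℝ → ℝ) : Prop :=
  TestFn φ ∧ ∃ ε : ℝ, 0 < ε ∧ ∀ t, t ≤ ε → ∀ x, φ t x = 0

/-- Membership in `W^{p,∞}(a,b)`: for `p = 0` it is `L^∞(a,b)`; for `p = k+1` it is
`C^{k,1}`, i.e. `C^k` with Lipschitz `k`-th derivative. -/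
def MemWpInf (p : ℕ) (f : ℝ → ℝ) (a b : ℝ) : Prop :=
  match p with
  | 0 => ∃ C : ℝ, ∀ᵐ x ∂(volume.restrict (Set.Ioo a b)), |f x| ≤ C
  | (k+1) => ContDiffOn ℝ k f (Set.Ioo a b) ∧
      ∃ K : NNReal, LipschitzOnWith K (iteratedDerivWithin k f (Set.Ioo a b)) (Set.Ioo a b)

/-- `(u,ρ,μ)` is `p`-regular on `(a,b)`: `u ∈ W^{p,∞}(a,b)`, `ρ ∈ W^{p−1,∞}(a,b)` (as an
a.e.-defined function, i.e. some representative of `ρ` belongs to `W^{p−1,∞}(a,b)`),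
and `μ = μ_ac` on `(a,b)`. -/
def pRegular (p : ℕ) (u ρ : ℝ → ℝ) (μ : Measure ℝ) (a b : ℝ) : Prop :=
  MemWpInf p u a b ∧
  (∃ g : ℝ → ℝ, (∀ᵐ x ∂(volume.restrict (Set.Ioo a b)), g x = ρ x) ∧
    MemWpInf (p - 1) g a b) ∧
  (μ.singularPart volume) (Set.Ioo a b) = 0

end

/-- Generalized inverse of the characteristic. -/
lemma exists_geninv (y yξ : ℝ → ℝ) (hc : Continuous y) (hp : ∀ ξ, y (ξ + 1) = y ξ + 1)
    (hftc : ∀ a b : ℝ, y b - y a = ∫ ξ in a..b, yξ ξ)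
    (hint : ∀ a b, IntervalIntegrable yξ volume a b)
    (hpos : ∀ᵐ ξ ∂(volume : Measure ℝ), 0 ≤ yξ ξ) :
    Monotone y ∧ ∃ g : ℝ → ℝ, (∀ x ξ, g x ≤ ξ ↔ x ≤ y ξ) ∧ (∀ x, y (g x) = x) ∧
      (∀ x, g (x + 1) = g x + 1) ∧ Monotone g ∧
      Measure.map g volume = volume.withDensity (fun ξ => ENNReal.ofReal (yξ ξ)) := by
  have hmono : Monotone y := by
    intro a b hab
    have : 0 ≤ ∫ ξ in a..b, yξ ξ :=
      intervalIntegral.integral_nonneg_of_ae hab hpos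
    linarith [hftc a b]
  have hper : Periodic (fun ξ => y ξ - ξ) 1 := by
    intro ξ
    simp only [hp]; ring
  have hint' : ∀ n : ℤ, y n = y 0 + n := by
    intro n
    have := hper.int_mul n 0
    simp at this
    linarith
  have htop : Tendsto y atTop atTop := by
    refine tendsto_atTop.2 fun c => ?_
    filter_upwards [eventually_ge_atTop ((⌈c - y 0⌉ : ℤ) : ℝ)] with ξ hξ
    have h1 := hmono hξ
    rw [hint'] at h1
    linarith [Int.le_ceil (c - y 0)]
  have hbot : Tendsto y atBot atBot := by
    refine tendsto_atBot.2 fun c => ?_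
    filter_upwards [eventually_le_atBot ((⌊c - y 0⌋ : ℤ) : ℝ)] with ξ hξ
    have h1 := hmono hξ
    rw [hint'] at h1
    linarith [Int.floor_le (c - y 0)]
  have hsurj : Surjective y := hc.surjective htop hbot
  refine ⟨hmono, fun x => sInf {ξ | x ≤ y ξ}, ?_⟩
  have hne : ∀ x, {ξ | x ≤ y ξ}.Nonempty := fun x => by
    obtain ⟨ξ, h⟩ := hsurj x
    exact ⟨ξ, h.ge⟩
  have hbdd : ∀ x, BddBelow {ξ | x ≤ y ξ} := fun x => by
    obtain ⟨ξ, h⟩ := hsurj (x - 1)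
    refine ⟨ξ, fun η hη => ?_⟩
    by_contra hlt
    have := hmono (not_le.1 hlt).le
    have h2 : x ≤ y η := hη
    linarith
  have hmem : ∀ x, x ≤ y (sInf {ξ | x ≤ y ξ}) := fun x =>
    (isClosed_le continuous_const hc).csInf_mem (hne x) (hbdd x)
  generalize hg : (fun x => sInf {ξ | x ≤ y ξ}) = g
  have hg' : ∀ x, sInf {ξ | x ≤ y ξ} = g x := fun x => by rw [← hg]
  simp only [hg'] at hmem
  have hgal : ∀ x ξ, g x ≤ ξ ↔ x ≤ y ξ := by
    intro x ξ
    constructor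
    · intro h
      exact (hmem x).trans (hmono h)
    · intro h
      rw [← hg']
      exact csInf_le (hbdd x) h
  have hinv : ∀ x, y (g x) = x := by
    intro x
    refine le_antisymm ?_ (hmem x)
    obtain ⟨ξ, h⟩ := hsurj x
    have := hmono ((hgal x ξ).2 h.ge)
    rwa [h] at this
  have hgm : Monotone g := fun a b hab => (hgal a _).2 (hab.trans (hmem b))
  refine ⟨hgal, hinv, ?_, hgm, ?_⟩
  · intro x
    refine le_antisymm ((hgal _ _).2 ?_) ?_
    · rw [hp, hinv]
    · have : g x ≤ g (x + 1) - 1 := by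
        rw [hgal]
        have := hp (g (x + 1) - 1)
        rw [sub_add_cancel, hinv] at this
        linarith
      linarith
  · have key : ∀ a b : ℝ, a < b → Measure.map g volume (Ioc a b) = ENNReal.ofReal (y b - y a) := by
      intro a b hab
      rw [Measure.map_apply hgm.measurable measurableSet_Ioc]
      have : g ⁻¹' Ioc a b = Ioc (y a) (y b) := by
        ext x
        simp only [mem_preimage, mem_Ioc, hgal]
        rw [← not_le, hgal, not_le]
      rw [this, Real.volume_Ioc]
    refine Measure.ext_of_Ioc' _ _ ?_ ?_
    · intro a b hab
      rw [key a b hab]; exact ENNReal.ofReal_ne_top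
    · intro a b hab
      rw [key a b hab, withDensity_apply _ measurableSet_Ioc, hftc,
        intervalIntegral.integral_of_le hab.le,
        ofReal_integral_eq_lintegral_ofReal (hint a b).1 (ae_restrict_of_ae hpos)]

lemma aesm_of_ii {f : ℝ → ℝ} (h : ∀ a b, IntervalIntegrable f volume a b) :
    AEStronglyMeasurable f volume := by
  refine LocallyIntegrable.aestronglyMeasurable (fun x => ?_)
  refine ⟨Ioc (x - 1) (x + 1), Ioc_mem_nhds (by linarith) (by linarith), (h (x-1) (x+1)).1⟩

lemma ico_preimage {y g : ℝ → ℝ} (hgal : ∀ x ξ, g x ≤ ξ ↔ x ≤ y ξ) (hinv : ∀ x, y (g x) = x)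
    (a b : ℝ) : g ⁻¹' Ico (g a) (g b) = Ico a b := by
  ext x
  simp only [mem_preimage, mem_Ico]
  rw [← not_le, hgal, hgal, hinv, not_le]

lemma comp_ii {y g yξ w : ℝ → ℝ} (hgal : ∀ x ξ, g x ≤ ξ ↔ x ≤ y ξ) (hinv : ∀ x, y (g x) = x)
    (hgm : Monotone g)
    (hmap : Measure.map g volume = volume.withDensity (fun ξ => ENNReal.ofReal (yξ ξ)))
    (hy : AEMeasurable yξ volume) (hpos : ∀ᵐ ξ ∂(volume : Measure ℝ), 0 ≤ yξ ξ)
    (hw : AEStronglyMeasurable w volume) (C : ℝ)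
    (hb : ∀ᵐ ξ ∂(volume : Measure ℝ), |yξ ξ * w ξ| ≤ C) (a b : ℝ) :
    IntervalIntegrable (fun x => w (g x)) volume a b := by
  wlog hab : a ≤ b
  · exact (this hgal hinv hgm hmap hy hpos hw C hb b a (le_of_not_ge hab)).symm
  rw [intervalIntegrable_iff_integrableOn_Ico_of_le hab, ← ico_preimage hgal hinv]
  have hwm : AEStronglyMeasurable w (Measure.map g volume) := by
    rw [hmap]; exact hw.mono_ac (withDensity_absolutelyContinuous _ _)
  have hr : Measure.map g (volume.restrict (g ⁻¹' Ico (g a) (g b)))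
      = (volume.restrict (Ico (g a) (g b))).withDensity (fun ξ => ENNReal.ofReal (yξ ξ)) := by
    rw [← Measure.restrict_map hgm.measurable measurableSet_Ico, hmap,
      restrict_withDensity measurableSet_Ico]
  have : Integrable w (Measure.map g (volume.restrict (g ⁻¹' Ico (g a) (g b)))) := by
    rw [hr, integrable_withDensity_iff_integrable_smul₀' hy.restrict.ennreal_ofReal (by simp)]
    refine Measure.integrableOn_of_bounded (M := C) (by simp) ?_ ?_
    · exact (AEMeasurable.ennreal_toReal hy.ennreal_ofReal).aestronglyMeasurable.smul hw
    · refine ae_restrict_of_ae ?_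
      filter_upwards [hb, hpos] with ξ h1 h2
      rwa [ENNReal.toReal_ofReal h2]
  exact (integrable_map_measure this.aestronglyMeasurable hgm.measurable.aemeasurable).1 this

lemma comp_integral {y g yξ w : ℝ → ℝ} (hgal : ∀ x ξ, g x ≤ ξ ↔ x ≤ y ξ) (hinv : ∀ x, y (g x) = x)
    (hgm : Monotone g)
    (hmap : Measure.map g volume = volume.withDensity (fun ξ => ENNReal.ofReal (yξ ξ)))
    (hy : AEMeasurable yξ volume) (hpos : ∀ᵐ ξ ∂(volume : Measure ℝ), 0 ≤ yξ ξ)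
    (hw : AEStronglyMeasurable w volume) (a b : ℝ) :
    ∫ x in a..b, w (g x) = ∫ ξ in (g a)..(g b), yξ ξ * w ξ := by
  wlog hab : a ≤ b
  · rw [intervalIntegral.integral_symm, this hgal hinv hgm hmap hy hpos hw b a (le_of_not_ge hab),
      ← intervalIntegral.integral_symm]
  rw [intervalIntegral.integral_of_le hab, intervalIntegral.integral_of_le (hgm hab),
    ← integral_Ico_eq_integral_Ioc, ← integral_Ico_eq_integral_Ioc, ← ico_preimage hgal hinv]
  have hwm : AEStronglyMeasurable w (Measure.map g volume) := by
    rw [hmap]; exact hw.mono_ac (withDensity_absolutelyContinuous _ _)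
  rw [← setIntegral_map measurableSet_Ico hwm hgm.measurable.aemeasurable, hmap,
    restrict_withDensity measurableSet_Ico,
    integral_withDensity_eq_integral_toReal_smul₀ hy.restrict.ennreal_ofReal (by simp)]
  refine integral_congr_ae (ae_restrict_of_ae ?_)
  filter_upwards [hpos] with ξ h
  rw [ENNReal.toReal_ofReal h, smul_eq_mul]

/-- The map `M` from Lagrangian to Eulerian coordinates is well defined from `F` to `D`:
for `X = (y,U,ν,r) ∈ F`, setting `u(x) = U(ξ)` for `x = y(ξ)` is well defined,
`μ = y_#(ν dξ)`, and the pushforward `y_#(r dξ)` is absolutely continuous, with density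
`ρ`; the resulting triple `(u,ρ,μ)` belongs to `D`. -/
theorem M_maps_F_to_D (X : LagVar) (hX : InF X) :
    (∀ ξ₁ ξ₂, X.y ξ₁ = X.y ξ₂ → X.U ξ₁ = X.U ξ₂) ∧
    ∃ u ux ρ : ℝ → ℝ,
      MRel X u ρ
        (MeasureTheory.Measure.map X.y
          (MeasureTheory.volume.withDensity fun ξ => ENNReal.ofReal (X.ν ξ))) ∧
      InD u ux ρ
        (MeasureTheory.Measure.map X.y
          (MeasureTheory.volume.withDensity fun ξ => ENNReal.ofReal (X.ν ξ))) := by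
  obtain ⟨⟨hyc, hUc, hyp, hUp, hνp, hrp, hyξp, hUξp, hyftc, hUftc, hyi, hUi, hνi, hri⟩,
    ⟨C, hC⟩, hypos, hνpos, -, hid⟩ := hX
  obtain ⟨y, U, ν, r, yξ, Uξ⟩ := X
  simp only at *
  unfold MRel
  simp only
  have hyi' := fun a b => Periodic.intervalIntegrable₀ hyξp one_ne_zero hyi a b
  have hUi' := fun a b => Periodic.intervalIntegrable₀ hUξp one_ne_zero hUi a b
  have hνi' := fun a b => Periodic.intervalIntegrable₀ hνp one_ne_zero hνi a b
  have hri' := fun a b => Periodic.intervalIntegrable₀ hrp one_ne_zero hri a b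
  have hym := (aesm_of_ii hyi').aemeasurable
  have hUm := (aesm_of_ii hUi').aemeasurable
  have hνm := (aesm_of_ii hνi').aemeasurable
  have hrm := (aesm_of_ii hri').aemeasurable
  obtain ⟨hymono, g, hgal, hinv, hgp, hgm, hmap⟩ :=
    exists_geninv y yξ hyc hyp hyftc hyi' hypos
  -- where `yξ` vanishes, so do `Uξ` and `r`
  have hUz : ∀ᵐ ξ ∂(volume : Measure ℝ), yξ ξ * (Uξ ξ / yξ ξ) = Uξ ξ := by
    filter_upwards [hid] with ξ h
    by_cases h0 : yξ ξ = 0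
    · rw [h0] at h ⊢
      have : Uξ ξ = 0 := by nlinarith [sq_nonneg (Uξ ξ), sq_nonneg (r ξ)]
      simp [this]
    · field_simp
  have hrz : ∀ᵐ ξ ∂(volume : Measure ℝ), yξ ξ * (r ξ / yξ ξ) = r ξ := by
    filter_upwards [hid] with ξ h
    by_cases h0 : yξ ξ = 0
    · rw [h0] at h ⊢
      have : r ξ = 0 := by nlinarith [sq_nonneg (Uξ ξ), sq_nonneg (r ξ)]
      simp [this]
    · field_simp
  -- energy identity in Eulerian form
  have hen : ∀ᵐ ξ ∂(volume : Measure ℝ), yξ ξ ≠ 0 →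
      yξ ξ * ((U ξ) ^ 2 + (Uξ ξ / yξ ξ) ^ 2 + (r ξ / yξ ξ) ^ 2) = ν ξ := by
    filter_upwards [hid] with ξ h h0
    field_simp
    linarith
  have haux : ∀ a b, y a = y b → a ≤ b → U a = U b := by
    intro a b hab hle
    have h0 : ∫ ξ in a..b, yξ ξ = 0 := by rw [← hyftc]; linarith
    rw [intervalIntegral.integral_of_le hle,
      integral_eq_zero_iff_of_nonneg_ae (ae_restrict_of_ae hypos) (hyi' a b).1] at h0
    have h1 : ∫ ξ in a..b, Uξ ξ = 0 := by
      rw [intervalIntegral.integral_of_le hle]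
      refine integral_eq_zero_of_ae ?_
      filter_upwards [h0, ae_restrict_of_ae hUz] with ξ h2 h3
      rw [← h3, h2]; simp
    rw [← hUftc] at h1
    linarith
  have hwell : ∀ ξ₁ ξ₂, y ξ₁ = y ξ₂ → U ξ₁ = U ξ₂ := by
    intro a b hab
    rcases le_total a b with h | h
    · exact haux a b hab h
    · exact (haux b a hab.symm h).symm
  have hUw : AEStronglyMeasurable (fun ξ => Uξ ξ / yξ ξ) volume :=
    (hUm.div hym).aestronglyMeasurable
  have hrw : AEStronglyMeasurable (fun ξ => r ξ / yξ ξ) volume :=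
    (hrm.div hym).aestronglyMeasurable
  have huxi := comp_ii hgal hinv hgm hmap hym hypos hUw C (by
    filter_upwards [hUz, hC] with ξ h1 h2
    rw [h1]; exact h2.2.1)
  have hux2 := comp_ii (w := fun ξ => (Uξ ξ / yξ ξ) ^ 2) hgal hinv hgm hmap hym hypos
    (hUw.pow 2) C (by
    filter_upwards [hen, hypos, hνpos, hC] with ξ h1 h2 h3 h4
    by_cases h0 : yξ ξ = 0
    · rw [h0]; simp; exact (abs_nonneg _).trans h4.1
    · rw [abs_of_nonneg (by positivity)]
      have h5 := h1 h0
      have : 0 ≤ yξ ξ * ((U ξ) ^ 2 + (r ξ / yξ ξ) ^ 2) := by positivity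
      have := le_abs_self (ν ξ)
      nlinarith [h4.2.2.1])
  have hρ2 := comp_ii (w := fun ξ => (r ξ / yξ ξ) ^ 2) hgal hinv hgm hmap hym hypos
    (hrw.pow 2) C (by
    filter_upwards [hen, hypos, hνpos, hC] with ξ h1 h2 h3 h4
    by_cases h0 : yξ ξ = 0
    · rw [h0]; simp; exact (abs_nonneg _).trans h4.1
    · rw [abs_of_nonneg (by positivity)]
      have h5 := h1 h0
      have : 0 ≤ yξ ξ * ((U ξ) ^ 2 + (Uξ ξ / yξ ξ) ^ 2) := by positivity
      have := le_abs_self (ν ξ)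
      nlinarith [h4.2.2.1])
  have hftc : ∀ a b : ℝ, U (g b) - U (g a) = ∫ x in a..b, Uξ (g x) / yξ (g x) := by
    intro a b
    rw [comp_integral (w := fun ξ => Uξ ξ / yξ ξ) hgal hinv hgm hmap hym hypos hUw, hUftc]
    refine intervalIntegral.integral_congr_ae ?_
    filter_upwards [hUz] with ξ h _
    exact h.symm
  refine ⟨hwell, fun x => U (g x), fun x => Uξ (g x) / yξ (g x), fun x => r (g x) / yξ (g x),
    ⟨?_, trivial, ?_⟩, ?_, ?_, ?_, ?_, hftc, hux2 0 1, hρ2 0 1, ?_, ?_, ?_⟩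
  · intro ξ
    exact hwell _ _ (hinv _)
  · intro φ hφ _
    have hm : AEStronglyMeasurable (fun ξ => φ (y ξ) * (r ξ / yξ ξ)) (Measure.map g volume) := by
      rw [hmap]
      exact ((hφ.comp hyc).aestronglyMeasurable.mul hrw).mono_ac
        (withDensity_absolutelyContinuous _ _)
    have h1 := integral_map hgm.measurable.aemeasurable hm
    simp only [hinv] at h1
    rw [← h1, hmap,
      integral_withDensity_eq_integral_toReal_smul₀ hym.ennreal_ofReal (by simp)]
    refine integral_congr_ae ?_
    filter_upwards [hypos, hrz] with ξ h2 h3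
    rw [ENNReal.toReal_ofReal h2, smul_eq_mul]
    linear_combination φ (y ξ) * h3
  · have : (fun x => U (g x)) = fun x => U (g 0) + ∫ x in (0:ℝ)..x, Uξ (g x) / yξ (g x) := by
      funext x
      rw [← hftc]; ring
    rw [this]
    exact continuous_const.add (intervalIntegral.continuous_primitive huxi 0)
  · intro x; simp only [hgp, hUp]
  · intro x; simp only [hgp, hUξp, hyξp]
  · intro x; simp only [hgp, hrp, hyξp]
  · refine ⟨fun x => ⟨Ioo (x - 1) (x + 1), Ioo_mem_nhds (by linarith) (by linarith), ?_⟩⟩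
    rw [Measure.map_apply hyc.measurable measurableSet_Ioo]
    have hsub : y ⁻¹' Ioo (x - 1) (x + 1) ⊆ Ioc (g (x - 1) - 1) (g (x + 1)) := by
      intro ξ hξ
      simp only [mem_preimage, mem_Ioo] at hξ
      constructor
      · have := (hgal (x - 1) ξ).2 hξ.1.le
        linarith
      · by_contra h
        have := hymono (not_le.1 h).le
        rw [hinv] at this
        linarith [hξ.2]
    refine (measure_mono hsub).trans_lt ?_
    rw [withDensity_apply _ measurableSet_Ioc]
    exact (hνi' _ _).1.lintegral_lt_top
  · have hT : Measurable (fun x : ℝ => x + 1) := measurable_add_const 1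
    rw [Measure.map_map hT hyc.measurable]
    have : (fun x : ℝ => x + 1) ∘ y = y ∘ (fun x : ℝ => x + 1) := by
      funext ξ; simp [hyp]
    rw [this, ← Measure.map_map hyc.measurable hT]
    congr 1
    ext s hs
    rw [Measure.map_apply hT hs, withDensity_apply _ (hT hs), withDensity_apply _ hs]
    have h1 := (measurePreserving_add_right volume (1:ℝ)).setLIntegral_comp_preimage_emb
        (MeasurableEquiv.addRight (1:ℝ)).measurableEmbedding (fun ξ => ENNReal.ofReal (ν ξ)) s
    simp only [hνp] at h1
    exact h1
  · -- Lebesgue decomposition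
    obtain ⟨yM, hyM, hyMe⟩ := id hym
    set A : Set ℝ := {ξ | yM ξ = 0} with hA
    have hAm : MeasurableSet A := hyM (measurableSet_singleton 0)
    refine ⟨Measure.map y
      ((volume.withDensity fun ξ => ENNReal.ofReal (ν ξ)).restrict A), ?_, ?_⟩
    · have hcount := hgm.countable_not_continuousAt
      refine ⟨(g ⁻¹' A ∪ {x | ¬ ContinuousAt g x})ᶜ,
        ((hgm.measurable hAm).union hcount.measurableSet).compl, ?_, ?_⟩
      · rw [Measure.map_apply hyc.measurable
          ((hgm.measurable hAm).union hcount.measurableSet).compl,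
          Measure.restrict_apply' hAm]
        convert measure_empty (μ := volume.withDensity fun ξ => ENNReal.ofReal (ν ξ))
        rw [eq_empty_iff_forall_notMem]
        rintro ξ ⟨h1, h2⟩
        simp only [mem_preimage, mem_compl_iff, mem_union, mem_ofPred_eq, not_or, not_not] at h1
        apply h1.1
        have h3 : g (y ξ) = ξ := by
          refine le_antisymm ((hgal _ _).2 le_rfl) ?_
          refine ge_of_tendsto (h1.2.tendsto.mono_left (nhdsWithin_le_nhds (s := Ioi (y ξ)))) ?_
          filter_upwards [self_mem_nhdsWithin] with x hx
          by_contra h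
          have h4 := (hgal _ _).1 (not_le.1 h).le
          exact absurd hx (not_lt.2 h4)
        rwa [h3]
      · rw [compl_compl]
        refine measure_union_null ?_ (hcount.measure_zero _)
        rw [← Measure.map_apply hgm.measurable hAm, hmap, withDensity_apply _ hAm]
        rw [lintegral_eq_zero_iff' hym.ennreal_ofReal.restrict]
        filter_upwards [ae_restrict_of_ae hyMe, ae_restrict_mem hAm] with ξ h1 h2
        simp only [h1]
        rw [h2]; simp
    · have hac : Measure.map y
          ((volume.withDensity fun ξ => ENNReal.ofReal (ν ξ)).restrict Aᶜ) =
          volume.withDensity (fun x => ENNReal.ofReal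
            ((U (g x)) ^ 2 + (Uξ (g x) / yξ (g x)) ^ 2 + (r (g x) / yξ (g x)) ^ 2)) := by
        have hhm : AEMeasurable (fun ξ => ENNReal.ofReal
            ((U ξ) ^ 2 + (Uξ ξ / yξ ξ) ^ 2 + (r ξ / yξ ξ) ^ 2)) volume :=
          (((hUc.measurable.aemeasurable.pow_const 2).add (hUw.aemeasurable.pow_const 2)).add
            (hrw.aemeasurable.pow_const 2)).ennreal_ofReal
        ext s hs
        have hys := hyc.measurable hs
        have hpre : g ⁻¹' (y ⁻¹' s) = s := by
          ext x; simp [hinv]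
        rw [Measure.map_apply hyc.measurable hs, Measure.restrict_apply hys,
          withDensity_apply _ (hys.inter hAm.compl), withDensity_apply _ hs]
        have hhm' := hhm.mono_ac (withDensity_absolutelyContinuous volume
          (fun ξ => ENNReal.ofReal (yξ ξ)))
        rw [← hmap] at hhm'
        have hhm2 := hhm'.restrict (s := y ⁻¹' s)
        rw [Measure.restrict_map hgm.measurable hys] at hhm2
        have h1 := lintegral_map' hhm2 hgm.measurable.aemeasurable
        rw [hpre] at h1
        rw [← h1]
        nth_rewrite 2 [← hpre]
        rw [← Measure.restrict_map hgm.measurable hys, hmap,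
          setLIntegral_withDensity_eq_lintegral_mul₀ hym.ennreal_ofReal hhm hys,
          inter_comm, ← setLIntegral_indicator hAm.compl]
        refine lintegral_congr_ae (ae_restrict_of_ae ?_)
        filter_upwards [hen, hypos, hyMe] with ξ h2 h3 h4
        rw [Pi.mul_apply, ← ENNReal.ofReal_mul h3]
        by_cases h0 : yξ ξ = 0
        · rw [indicator_of_notMem, h0]
          · simp
          · rw [notMem_compl_iff]
            exact h4.symm.trans h0
        · rw [indicator_of_mem, h2 h0]
          exact fun h5 => h0 (h4.trans h5)
      rw [← hac, ← Measure.map_add _ _ hyc.measurable, add_comm,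
        Measure.restrict_add_restrict_compl hAm]
end

section
/- The mapping d_M : H^M × H^M → ℝ₊ is a metric on H^M. Moreover, there is a constant C_M depending only on M such that for any X_α, X_β ∈ H^M, writing R_α = ∫₀¹ r_α(η) dη and R_β = ∫₀¹ r_β(η) dη, one has ‖y_α − y_β‖_{L^∞} + ‖U_α − U_β‖_{L^∞} + |h_α − h_β| + |R_α − R_β| ≤ C_M d_M(X_α, X_β); and for all X_α, X_β ∈ F one has d(X_α, X_β) ≤ ‖X_α − X_β‖_E. -/
open MeasureTheory Real Set Filter Function

theorem InG.strictMono {g : Relabel} (hg : InG g) : StrictMono g.f := by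
  obtain ⟨h1, h2, h3, ⟨K, hK⟩, h5, h6⟩ := hg
  rcases Continuous.strictMono_of_inj hK.continuous h1.injective with h | h
  · exact h
  · have a := h (show (0:ℝ) < 0 + 1 by norm_num)
    have b := h3 0
    linarith

theorem InG.intervalIntegrable {g : Relabel} (hg : InG g) (a b : ℝ) :
    IntervalIntegrable g.fξ volume a b := by
  by_contra h
  have h6 := hg.2.2.2.2.2 a b
  rw [intervalIntegral.integral_undef h] at h6
  have : b = a := hg.1.injective (by linarith)
  subst this
  simp at h

theorem locInt_of_interval {q : ℝ → ℝ} (h : ∀ a b, IntervalIntegrable q volume a b) :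
    LocallyIntegrable q volume := by
  intro x
  refine ⟨Ioo (x-1) (x+1), Ioo_mem_nhds (by linarith) (by linarith), ?_⟩
  exact ((intervalIntegrable_iff_integrableOn_Ioc_of_le (by linarith)).1 (h (x-1) (x+1))).mono_set
    Ioo_subset_Ioc_self

theorem InG.ae_hasDerivAt {g : Relabel} (hg : InG g) :
    ∀ᵐ ξ ∂(volume : Measure ℝ), HasDerivAt g.f (g.fξ ξ) ξ := by
  have h := LocallyIntegrable.ae_hasDerivAt_integral (locInt_of_interval hg.intervalIntegrable)
  filter_upwards [h] with x hx
  have h1 := (hx 0).add_const (g.f 0)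
  refine h1.congr_of_eventuallyEq (Eventually.of_forall fun z => ?_)
  have := hg.2.2.2.2.2 0 z
  simp only
  linarith

theorem lip_null {f : ℝ → ℝ} {K : NNReal} (hf : LipschitzWith K f) {s : Set ℝ}
    (hs : volume s = 0) : volume (f '' s) = 0 := by
  rw [← hausdorffMeasure_real] at *
  have := (hf.lipschitzOnWith (s := s)).hausdorffMeasure_image_le (d := 1) zero_le_one
  rw [hs] at this
  simpa using this

theorem InG.cov {g : Relabel} (hg : InG g) {q : ℝ → ℝ}
    (hq : ∀ a b, IntervalIntegrable q volume a b) {a b : ℝ} (hab : a ≤ b) :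
    IntervalIntegrable (fun x => q (g.f x) * deriv g.f x) volume a b ∧
    ∫ x in a..b, q (g.f x) * deriv g.f x = ∫ x in (g.f a)..(g.f b), q x := by
  have hm := hg.strictMono
  obtain ⟨K, hK⟩ := hg.2.2.2.1
  have hfab : g.f a ≤ g.f b := hm.monotone hab
  set D : Set ℝ := {x | DifferentiableAt ℝ g.f x} with hD
  have hDm : MeasurableSet D := measurableSet_of_differentiableAt ℝ g.f
  have hDn : volume Dᶜ = 0 := by
    have : ∀ᵐ x ∂(volume : Measure ℝ), x ∈ D := by
      filter_upwards [hg.ae_hasDerivAt] with x hx using hx.differentiableAt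
    exact this
  set s := Icc a b ∩ D with hs
  have hsm : MeasurableSet s := measurableSet_Icc.inter hDm
  have hder : ∀ x ∈ s, HasDerivWithinAt g.f (deriv g.f x) s x := fun x hx =>
    hx.2.hasDerivAt.hasDerivWithinAt
  have himg : g.f '' Icc a b = Icc (g.f a) (g.f b) := by
    apply Subset.antisymm
    · rintro _ ⟨x, hx, rfl⟩
      exact ⟨hm.monotone hx.1, hm.monotone hx.2⟩
    · exact intermediate_value_Icc hab hK.continuous.continuousOn
  have hs_ae : s =ᵐ[volume] Icc a b := by
    refine inter_ae_eq_left_of_ae_eq_univ ?_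
    exact ae_eq_univ.2 hDn
  have hfs_ae : g.f '' s =ᵐ[volume] Icc (g.f a) (g.f b) := by
    rw [← himg]
    have h1 : g.f '' s ⊆ g.f '' Icc a b := image_mono inter_subset_left
    refine (LE.le.eventuallyLE h1).antisymm ?_
    rw [ae_le_set]
    refine measure_mono_null ?_ (lip_null hK hDn)
    rintro _ ⟨⟨x, hx, rfl⟩, h2⟩
    refine ⟨x, fun hxD => h2 ⟨x, ⟨hx, hxD⟩, rfl⟩, rfl⟩
  have hmon : MonotoneOn g.f s := hm.monotone.monotoneOn _
  have e1 := integrableOn_image_iff_integrableOn_deriv_smul_of_monotoneOn hsm hder hmon q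
  have e2 := integral_image_eq_integral_deriv_smul_of_monotoneOn hsm hder hmon q
  simp only [smul_eq_mul, mul_comm (deriv g.f _)] at e1 e2
  rw [integrableOn_congr_set_ae hfs_ae, integrableOn_congr_set_ae hs_ae] at e1
  rw [setIntegral_congr_set hfs_ae, setIntegral_congr_set hs_ae] at e2
  constructor
  · rw [intervalIntegrable_iff_integrableOn_Icc_of_le hab]
    exact e1.1 ((intervalIntegrable_iff_integrableOn_Icc_of_le hfab).1 (hq _ _))
  · rw [intervalIntegral.integral_of_le hab, intervalIntegral.integral_of_le hfab,
      ← integral_Icc_eq_integral_Ioc, ← integral_Icc_eq_integral_Ioc, e2]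

theorem periodic_ii {q : ℝ → ℝ} (hp : ∀ x, q (x+1) = q x) (h : IntervalIntegrable q volume 0 1)
    (a b : ℝ) : IntervalIntegrable q volume a b := by
  have hp' : Function.Periodic q 1 := hp
  exact hp'.intervalIntegrable₀ one_ne_zero h a b

theorem InG.deriv_periodic {g : Relabel} (hg : InG g) (x : ℝ) :
    deriv g.f (x+1) = deriv g.f x := by
  rw [← deriv_comp_add_const]
  have : (fun x => g.f (x+1)) = fun x => g.f x + 1 := funext hg.2.2.1
  rw [this, deriv_add_const]

/-- L1 difference controls difference of integrals over corresponding intervals -/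
theorem cov_diff {f g : Relabel} (hf : InG f) (hg : InG g) {p q : ℝ → ℝ}
    (hpp : ∀ x, p (x+1) = p x) (hqp : ∀ x, q (x+1) = q x)
    (hp : IntervalIntegrable p volume 0 1) (hq : IntervalIntegrable q volume 0 1)
    {a b : ℝ} (hab : a ≤ b) (hab1 : b ≤ a + 1) :
    |(∫ x in (f.f a)..(f.f b), p x) - ∫ x in (g.f a)..(g.f b), q x| ≤
      L1norm01 (fun ξ => p (f.f ξ) * f.fξ ξ - q (g.f ξ) * g.fξ ξ) := by
  have hp' := periodic_ii hpp hp
  have hq' := periodic_ii hqp hq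
  set A : ℝ → ℝ := fun ξ => p (f.f ξ) * deriv f.f ξ - q (g.f ξ) * deriv g.f ξ with hA
  have hAp : Function.Periodic (fun x => |A x|) 1 := by
    intro x
    simp only [hA, hf.deriv_periodic, hg.deriv_periodic, hf.2.2.1, hg.2.2.1, hpp, hqp]
  have hAi : ∀ a b, a ≤ b → IntervalIntegrable A volume a b := fun a b h =>
    (hf.cov hp' h).1.sub (hg.cov hq' h).1
  have e0 : L1norm01 (fun ξ => p (f.f ξ) * f.fξ ξ - q (g.f ξ) * g.fξ ξ)
      = ∫ x in (0:ℝ)..1, |A x| := by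
    unfold L1norm01
    apply intervalIntegral.integral_congr_ae
    filter_upwards [hf.ae_hasDerivAt, hg.ae_hasDerivAt] with x h1 h2 _
    simp only [hA, h1.deriv, h2.deriv]
  have e1 : ∫ x in (0:ℝ)..1, |A x| = ∫ x in a..(a+1), |A x| := by
    have := hAp.intervalIntegral_add_eq 0 a
    simpa using this
  rw [e0, e1, ← (hf.cov hp' hab).2, ← (hg.cov hq' hab).2,
    ← intervalIntegral.integral_sub (hf.cov hp' hab).1 (hg.cov hq' hab).1]
  calc |∫ x in a..b, A x| ≤ ∫ x in a..b, |A x| := intervalIntegral.abs_integral_le_integral_abs hab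
    _ ≤ ∫ x in a..(a+1), |A x| := by
      apply intervalIntegral.integral_mono_interval le_rfl hab hab1
      · exact Eventually.of_forall fun x => abs_nonneg _
      · exact (hAi a (a+1) (by linarith)).abs

theorem supNorm01_nonneg (f : ℝ → ℝ) : 0 ≤ supNorm01 f := by
  apply Real.sSup_nonneg
  rintro _ ⟨x, _, rfl⟩
  exact abs_nonneg _

theorem L1norm01_nonneg (f : ℝ → ℝ) : 0 ≤ L1norm01 f :=
  intervalIntegral.integral_nonneg zero_le_one fun _ _ => abs_nonneg _

theorem le_supNorm01 {f : ℝ → ℝ} (hf : Continuous f) (hp : ∀ x, f (x+1) = f x) (x : ℝ) :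
    |f x| ≤ supNorm01 f := by
  have hp' : Function.Periodic f 1 := hp
  have h1 : f (Int.fract x) = f x := by
    have := hp'.sub_int_mul_eq (x := x) ⌊x⌋
    rw [mul_one] at this
    exact this
  rw [← h1]
  apply le_csSup
  · exact (isCompact_Icc.image (continuous_abs.comp hf)).bddAbove
  · exact ⟨_, ⟨Int.fract_nonneg x, (Int.fract_lt_one x).le⟩, rfl⟩

theorem supNorm01_le {f : ℝ → ℝ} {C : ℝ} (h : ∀ x, |f x| ≤ C) : supNorm01 f ≤ C := by
  apply csSup_le ((nonempty_Icc.2 zero_le_one).image _)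
  rintro _ ⟨x, _, rfl⟩
  exact h x

theorem Edist_nonneg (X Y : LagVar) : 0 ≤ Edist X Y := by
  unfold Edist W11norm
  have h1 := supNorm01_nonneg
  have h2 := L1norm01_nonneg
  exact add_nonneg (add_nonneg (add_nonneg (add_nonneg (h1 _) (h2 _)) (add_nonneg (h1 _) (h2 _)))
    (h2 _)) (h2 _)

theorem int_bound {q : ℝ → ℝ} {L : ℝ} (hq : ∀ᵐ ξ ∂(volume : Measure ℝ), |q ξ| ≤ L) (a b : ℝ) :
    |∫ x in a..b, q x| ≤ L * |b - a| := by
  have := intervalIntegral.norm_integral_le_of_norm_le_const_ae (f := q) (a := a) (b := b) (C := L)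
    (by filter_upwards [hq] with x hx _ using hx)
  simpa using this

theorem InHM.h_nonneg {M : ℝ} {X : LagVar} (hX : InHM M X) : 0 ≤ ∫ ξ in (0:ℝ)..1, X.ν ξ := by
  apply intervalIntegral.integral_nonneg_of_ae zero_le_one
  exact hX.1.1.1.2.2.2.1

theorem InHM.bounds {M : ℝ} {X : LagVar} (hX : InHM M X) :
    ∀ᵐ ξ ∂(volume : Measure ℝ), |X.yξ ξ| ≤ 1 + M ∧ |X.Uξ ξ| ≤ 1 + M ∧ |X.ν ξ| ≤ 1 + M ∧
      |X.r ξ| ≤ 1 + M := by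
  have hM := hX.2
  filter_upwards [hX.1.1.2, hX.1.1.1.2.2.1, hX.1.1.1.2.2.2.1, hX.1.1.1.2.2.2.2.2] with x h1 h2 h3 h4
  have a1 : X.yξ x ≤ 1 + M := by linarith
  have a2 : X.ν x ≤ 1 + M := by linarith
  have a3 : X.yξ x * X.ν x ≤ (1 + M)^2 := by nlinarith
  have a0 : 0 ≤ 1 + M := by linarith
  refine ⟨by rwa [abs_of_nonneg h2], ?_, by rwa [abs_of_nonneg h3], ?_⟩
  · apply abs_le_of_sq_le_sq _ a0
    nlinarith [sq_nonneg (X.yξ x * X.U x), sq_nonneg (X.r x)]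
  · apply abs_le_of_sq_le_sq _ a0
    nlinarith [sq_nonneg (X.yξ x * X.U x), sq_nonneg (X.Uξ x)]

theorem shift_int {y : ℝ → ℝ} (hc : Continuous y) (hp : ∀ x, y (x+1) = y x + 1) (c : ℝ) :
    ∫ x in (0:ℝ)..1, y (x - c) = (∫ x in (0:ℝ)..1, y x) - c := by
  have hper : Function.Periodic (fun x => y x - x) 1 := by
    intro x; simp only [hp]; ring
  have e := hper.intervalIntegral_add_eq (-c) 0
  have hi : ∀ a b, IntervalIntegrable y volume a b := fun a b => hc.intervalIntegrable a b
  have hi2 : ∀ a b, IntervalIntegrable (fun x : ℝ => x) volume a b :=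
    fun a b => continuous_id.intervalIntegrable a b
  rw [intervalIntegral.integral_sub (hi _ _) (hi2 _ _),
    intervalIntegral.integral_sub (hi _ _) (hi2 _ _)] at e
  simp only [integral_id] at e
  rw [intervalIntegral.integral_comp_sub_right (fun x => y x) c]
  have e1 : (0:ℝ) - c = -c := by ring
  have e2 : (1:ℝ) - c = -c + 1 := by ring
  have e3 : (0:ℝ) + 1 = 1 := by ring
  rw [e1, e2]
  rw [e3] at e
  nlinarith

/-- The one-step estimate. -/
theorem onestep {M : ℝ} {Xa Xb : LagVar} (ha : InHM M Xa) (hb : InHM M Xb)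
    {f g : Relabel} (hf : InG f) (hg : InG g) {δ : ℝ} (hδ : δ = Edist (act Xa f) (act Xb g)) :
    (∀ x, |Xa.y x - Xb.y x| ≤ (20 * (1 + M)^2) * δ) ∧
    (∀ x, |Xa.U x - Xb.U x| ≤ (20 * (1 + M)^2) * δ) ∧
    (∀ a b, a ≤ b → b ≤ a + 1 →
      |(∫ x in a..b, Xa.ν x) - ∫ x in a..b, Xb.ν x| ≤ (20 * (1 + M)^2) * δ) ∧
    (∀ a b, a ≤ b → b ≤ a + 1 →
      |(∫ x in a..b, Xa.r x) - ∫ x in a..b, Xb.r x| ≤ (20 * (1 + M)^2) * δ) := by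
  have Ba := ha.bounds
  have Bb := hb.bounds
  have ha0 := ha.h_nonneg
  have hb0 := hb.h_nonneg
  have haM := ha.2
  have hbM := hb.2
  obtain ⟨⟨⟨⟨cya, cUa, pya, pUa, pνa, pra, -, -, Iya, IUa, iya, iUa, iνa, ira⟩, -⟩, Fa⟩, Ma⟩ := ha.1
  obtain ⟨⟨⟨⟨cyb, cUb, pyb, pUb, pνb, prb, -, -, Iyb, IUb, iyb, iUb, iνb, irb⟩, -⟩, Fb⟩, Mb⟩ := hb.1
  set hha := ∫ ξ in (0:ℝ)..1, Xa.ν ξ with hha_def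
  set hhb := ∫ ξ in (0:ℝ)..1, Xb.ν ξ with hhb_def
  have hL : 1 ≤ 1 + M := by linarith
  obtain ⟨Kf, hKf⟩ := hf.2.2.2.1
  obtain ⟨Kg, hKg⟩ := hg.2.2.2.1
  have cf := hKf.continuous
  have cg := hKg.continuous
  have hfp := hf.2.2.1
  have hgp := hg.2.2.1
  have hfi := hf.2.1
  have hgi := hg.2.1
  -- components of the E-distance
  have s1 := supNorm01_nonneg (fun ξ => (act Xa f).y ξ - (act Xb g).y ξ)
  have s2 := supNorm01_nonneg (fun ξ => (act Xa f).U ξ - (act Xb g).U ξ)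
  have l1 := L1norm01_nonneg (fun ξ => (act Xa f).yξ ξ - (act Xb g).yξ ξ)
  have l2 := L1norm01_nonneg (fun ξ => (act Xa f).Uξ ξ - (act Xb g).Uξ ξ)
  have l3 := L1norm01_nonneg (fun ξ => (act Xa f).ν ξ - (act Xb g).ν ξ)
  have l4 := L1norm01_nonneg (fun ξ => (act Xa f).r ξ - (act Xb g).r ξ)
  have hδ0 : 0 ≤ δ := hδ ▸ Edist_nonneg _ _
  unfold Edist W11norm at hδ
  have dy : ∀ ξ, |Xa.y (f.f ξ) - Xb.y (g.f ξ)| ≤ δ := by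
    intro ξ
    have := le_supNorm01 (f := fun ξ => Xa.y (f.f ξ) - Xb.y (g.f ξ))
      ((cya.comp cf).sub (cyb.comp cg)) (by intro x; simp only [hfp, hgp, pya, pyb]; ring) ξ
    refine this.trans ?_
    simp only [act] at *
    linarith
  have dU : ∀ ξ, |Xa.U (f.f ξ) - Xb.U (g.f ξ)| ≤ δ := by
    intro ξ
    have := le_supNorm01 (f := fun ξ => Xa.U (f.f ξ) - Xb.U (g.f ξ))
      ((cUa.comp cf).sub (cUb.comp cg)) (by intro x; simp only [hfp, hgp, pUa, pUb]) ξ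
    refine this.trans ?_
    simp only [act] at *
    linarith
  have dν : ∀ a b, a ≤ b → b ≤ a + 1 →
      |(∫ x in (f.f a)..(f.f b), Xa.ν x) - ∫ x in (g.f a)..(g.f b), Xb.ν x| ≤ δ := by
    intro a b h1 h2
    refine (cov_diff hf hg pνa pνb iνa iνb h1 h2).trans ?_
    simp only [act] at *
    linarith
  have dr : ∀ a b, a ≤ b → b ≤ a + 1 →
      |(∫ x in (f.f a)..(f.f b), Xa.r x) - ∫ x in (g.f a)..(g.f b), Xb.r x| ≤ δ := by
    intro a b h1 h2
    refine (cov_diff hf hg pra prb ira irb h1 h2).trans ?_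
    simp only [act] at *
    linarith
  clear s1 s2 l1 l2 l3 l4 hδ
  -- energies
  have dh : |hha - hhb| ≤ δ := by
    have := dν 0 1 zero_le_one (by norm_num)
    have ea : f.f 1 = f.f 0 + 1 := by rw [← hfp]; norm_num
    have eb : g.f 1 = g.f 0 + 1 := by rw [← hgp]; norm_num
    have pa : Function.Periodic Xa.ν 1 := pνa
    have pb : Function.Periodic Xb.ν 1 := pνb
    rw [ea, eb, pa.intervalIntegral_add_eq (f.f 0) 0, pb.intervalIntegral_add_eq (g.f 0) 0] at this
    simpa using this
  -- linear structure
  have lina : ∀ a b, (1 + hha) * (b - a) = (Xa.y b - Xa.y a) + ∫ x in a..b, Xa.ν x := by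
    intro a b
    have iy : IntervalIntegrable Xa.yξ volume a b :=
      periodic_ii (ha.1.1.1.1.2.2.2.2.2.2.1) iya a b
    rw [Iya, ← intervalIntegral.integral_add iy (periodic_ii pνa iνa a b)]
    rw [intervalIntegral.integral_congr_ae (g := fun _ => 1 + hha)
      (by filter_upwards [Fa] with x hx _ using hx)]
    simp; ring
  have linb : ∀ a b, (1 + hhb) * (b - a) = (Xb.y b - Xb.y a) + ∫ x in a..b, Xb.ν x := by
    intro a b
    have iy : IntervalIntegrable Xb.yξ volume a b :=
      periodic_ii (hb.1.1.1.1.2.2.2.2.2.2.1) iyb a b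
    rw [Iyb, ← intervalIntegral.integral_add iy (periodic_ii pνb iνb a b)]
    rw [intervalIntegral.integral_congr_ae (g := fun _ => 1 + hhb)
      (by filter_upwards [Fb] with x hx _ using hx)]
    simp; ring
  have mf := hf.strictMono.monotone
  have mg := hg.strictMono.monotone
  set c := f.f 0 - g.f 0 with hc
  have dfg01 : ∀ ξ, 0 ≤ ξ → ξ ≤ 1 → |f.f ξ - g.f ξ - c| ≤ 4 * δ := by
    intro ξ h0 h1
    have e1 := lina (f.f 0) (f.f ξ)
    have e2 := linb (g.f 0) (g.f ξ)
    have e3 := abs_le.1 (dν 0 ξ h0 (by linarith))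
    have e4 := abs_le.1 (dy 0)
    have e5 := abs_le.1 (dy ξ)
    have e6 := abs_le.1 dh
    have t0 : 0 ≤ f.f ξ - f.f 0 := by linarith [mf h0]
    have t1 : f.f ξ - f.f 0 ≤ 1 := by
      have := mf h1
      have ea : f.f 1 = f.f 0 + 1 := by rw [← hfp]; norm_num
      linarith
    have key : (1 + hhb) * (f.f ξ - g.f ξ - c) = (1 + hha) * (f.f ξ - f.f 0)
        - (1 + hhb) * (g.f ξ - g.f 0) - (hha - hhb) * (f.f ξ - f.f 0) := by
      rw [hc]; ring
    have k2 : |(hha - hhb) * (f.f ξ - f.f 0)| ≤ δ := by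
      rw [abs_mul, abs_of_nonneg t0]
      calc _ ≤ δ * 1 := mul_le_mul dh t1 t0 hδ0
        _ = δ := mul_one _
    have k3 := abs_le.1 k2
    have k4 : |(1 + hhb) * (f.f ξ - g.f ξ - c)| ≤ 4 * δ := by
      rw [key, e1, e2, abs_le]
      constructor <;> linarith
    rw [abs_mul, abs_of_nonneg (by linarith : 0 ≤ 1 + hhb)] at k4
    nlinarith [abs_nonneg (f.f ξ - g.f ξ - c)]
  have dfg : ∀ ξ, |f.f ξ - g.f ξ - c| ≤ 4 * δ := by
    intro ξ
    have hp' : Function.Periodic (fun ξ => f.f ξ - g.f ξ) 1 := by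
      intro x; simp only [hfp, hgp]; ring
    have h1 := hp'.sub_int_mul_eq (x := ξ) ⌊ξ⌋
    rw [mul_one] at h1
    rw [← h1]
    exact dfg01 (Int.fract ξ) (Int.fract_nonneg ξ) (Int.fract_lt_one ξ).le
  have lipy : ∀ a b, |Xb.y b - Xb.y a| ≤ (1 + M) * |b - a| := by
    intro a b
    rw [Iyb]
    exact int_bound (by filter_upwards [Bb] with x hx using hx.1) a b
  have lipU : ∀ a b, |Xb.U b - Xb.U a| ≤ (1 + M) * |b - a| := by
    intro a b
    rw [IUb]
    exact int_bound (by filter_upwards [Bb] with x hx using hx.2.1) a b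
  have lipν : ∀ a b, |∫ x in a..b, Xb.ν x| ≤ (1 + M) * |b - a| := fun a b =>
    int_bound (by filter_upwards [Bb] with x hx using hx.2.2.1) a b
  have lipr : ∀ a b, |∫ x in a..b, Xb.r x| ≤ (1 + M) * |b - a| := fun a b =>
    int_bound (by filter_upwards [Bb] with x hx using hx.2.2.2) a b
  -- bound on c
  have dshift : ∀ x, |Xa.y x - Xb.y (x - c)| ≤ 5 * (1 + M) * δ := by
    intro x
    have e1 := dy (f.finv x)
    have e2 := dfg (f.finv x)
    rw [hfi x] at e1 e2
    have e3 := lipy (x - c) (g.f (f.finv x))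
    have e4 : |g.f (f.finv x) - (x - c)| ≤ 4 * δ := by
      rw [abs_sub_comm]
      convert e2 using 2
      ring
    have e5 : (1 + M) * |g.f (f.finv x) - (x - c)| ≤ (1 + M) * (4 * δ) := by gcongr
    have e6 := abs_le.1 e1
    have e7 := abs_le.1 (e3.trans e5)
    rw [abs_le]
    constructor <;> nlinarith
  have hcb : |c| ≤ 5 * (1 + M) * δ := by
    have e1 := shift_int cyb pyb c
    have cs : Continuous fun x => Xb.y (x - c) := cyb.comp (continuous_id.sub continuous_const)
    have e2 : ∫ x in (0:ℝ)..1, (Xa.y x - Xb.y (x - c)) = c := by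
      rw [intervalIntegral.integral_sub (cya.intervalIntegrable _ _) (cs.intervalIntegrable _ _),
        e1, Ma, Mb]
      ring
    have := int_bound (q := fun x => Xa.y x - Xb.y (x - c)) (Eventually.of_forall dshift) 0 1
    rw [e2] at this
    simpa using this
  have dfg' : ∀ ξ, |f.f ξ - g.f ξ| ≤ 9 * (1 + M) * δ := by
    intro ξ
    have e1 := abs_le.1 (dfg ξ)
    have e2 := abs_le.1 hcb
    rw [abs_le]
    constructor <;> nlinarith
  have hgf : ∀ x, |x - g.f (f.finv x)| ≤ 9 * (1 + M) * δ := by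
    intro x
    have := dfg' (f.finv x)
    rwa [hfi x] at this
  have hLg : ∀ x, (1 + M) * |x - g.f (f.finv x)| ≤ 9 * (1 + M)^2 * δ := by
    intro x
    calc (1 + M) * |x - g.f (f.finv x)| ≤ (1 + M) * (9 * (1 + M) * δ) := by
          gcongr
          exact hgf x
      _ = _ := by ring
  have hLδ : δ ≤ (1 + M)^2 * δ := le_mul_of_one_le_left hδ0 (one_le_pow₀ hL)
  have minv : ∀ a b, a ≤ b → f.finv a ≤ f.finv b := by
    intro a b hab
    rw [← hf.strictMono.le_iff_le, hfi a, hfi b]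
    exact hab
  have pinv : ∀ a, f.finv (a + 1) = f.finv a + 1 := by
    intro a
    apply hf.1.injective
    rw [hfi (a+1), hfp, hfi a]
  -- general primitive estimate
  have prim : ∀ p q : ℝ → ℝ, (∀ a b, IntervalIntegrable q volume a b) →
      (∀ a b, |∫ x in a..b, q x| ≤ (1 + M) * |b - a|) →
      (∀ a b, a ≤ b → b ≤ a + 1 →
        |(∫ x in (f.f a)..(f.f b), p x) - ∫ x in (g.f a)..(g.f b), q x| ≤ δ) →
      ∀ a b, a ≤ b → b ≤ a + 1 →
      |(∫ x in a..b, p x) - ∫ x in a..b, q x| ≤ (20 * (1 + M)^2) * δ := by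
    intro p q hq hlip hd a b hab hab1
    have e1 := hd (f.finv a) (f.finv b) (minv a b hab) (by rw [← pinv]; exact minv _ _ hab1)
    rw [hfi a, hfi b] at e1
    have e2 := (hlip (g.f (f.finv a)) a).trans (hLg a)
    have e3 := (hlip (g.f (f.finv b)) b).trans (hLg b)
    have e4 : (∫ x in a..b, q x) = (∫ x in (g.f (f.finv a))..(g.f (f.finv b)), q x)
        - (∫ x in (g.f (f.finv a))..a, q x) + ∫ x in (g.f (f.finv b))..b, q x := by
      have t1 := intervalIntegral.integral_add_adjacent_intervals
        (hq (g.f (f.finv a)) a) (hq a b)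
      have t2 := intervalIntegral.integral_add_adjacent_intervals
        (hq (g.f (f.finv a)) (g.f (f.finv b))) (hq (g.f (f.finv b)) b)
      linarith
    rw [e4]
    have e1' := abs_le.1 e1
    have e2' := abs_le.1 e2
    have e3' := abs_le.1 e3
    rw [abs_le]
    constructor <;> nlinarith
  refine ⟨?_, ?_, prim _ _ (periodic_ii pνb iνb) lipν dν, prim _ _ (periodic_ii prb irb) lipr dr⟩
  · intro x
    have e1 := dy (f.finv x)
    rw [hfi x] at e1
    have e1' := abs_le.1 e1
    have e2' := abs_le.1 ((lipy (g.f (f.finv x)) x).trans (hLg x))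
    rw [abs_le]
    constructor <;> nlinarith
  · intro x
    have e1 := dU (f.finv x)
    rw [hfi x] at e1
    have e1' := abs_le.1 e1
    have e2' := abs_le.1 ((lipU (g.f (f.finv x)) x).trans (hLg x))
    rw [abs_le]
    constructor <;> nlinarith

/-- The identity relabeling. -/
def idR : Relabel := ⟨fun x => x, fun x => x, fun _ => 1⟩

theorem inG_idR : InG idR := by
  refine ⟨fun x => rfl, fun x => rfl, fun x => rfl, ⟨1, LipschitzWith.id⟩, ⟨1, LipschitzWith.id⟩, ?_⟩
  intro a b
  simp [idR]

theorem act_idR (X : LagVar) : act X idR = X := by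
  cases X
  simp [act, idR]

theorem J_set_bdd (Xa Xb : LagVar) :
    BddBelow {v : ℝ | ∃ f g : Relabel, InG f ∧ InG g ∧ v = Edist (act Xa f) (act Xb g)} := by
  refine ⟨0, ?_⟩
  rintro v ⟨f, g, -, -, rfl⟩
  exact Edist_nonneg _ _

theorem Jfun_nonneg (Xa Xb : LagVar) : 0 ≤ Jfun Xa Xb := by
  apply Real.sInf_nonneg
  rintro v ⟨f, g, -, -, rfl⟩
  exact Edist_nonneg _ _

theorem Jfun_le_Edist (Xa Xb : LagVar) : Jfun Xa Xb ≤ Edist Xa Xb :=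
  csInf_le (J_set_bdd Xa Xb) ⟨idR, idR, inG_idR, inG_idR, by rw [act_idR, act_idR]⟩

theorem Edist_comm (X Y : LagVar) : Edist X Y = Edist Y X := by
  unfold Edist W11norm supNorm01 L1norm01
  simp only [abs_sub_comm]

theorem Edist_self (X : LagVar) : Edist X X = 0 := by
  unfold Edist W11norm supNorm01 L1norm01
  simp [(nonempty_Icc.2 (zero_le_one (α := ℝ))).image_const]

theorem Jfun_comm (X Y : LagVar) : Jfun X Y = Jfun Y X := by
  unfold Jfun
  congr 1
  ext v
  constructor
  · rintro ⟨f, g, hf, hg, rfl⟩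
    exact ⟨g, f, hg, hf, Edist_comm _ _⟩
  · rintro ⟨f, g, hf, hg, rfl⟩
    exact ⟨g, f, hg, hf, Edist_comm _ _⟩

theorem Jfun_self (X : LagVar) : Jfun X X = 0 :=
  le_antisymm ((Jfun_le_Edist X X).trans (Edist_self X).le) (Jfun_nonneg X X)

theorem le_mul_sInf {S : Set ℝ} (hS : S.Nonempty) {K φ : ℝ} (hK : 0 < K)
    (h : ∀ v ∈ S, φ ≤ K * v) : φ ≤ K * sInf S := by
  have : φ / K ≤ sInf S := by
    apply le_csInf hS
    intro v hv
    rw [div_le_iff₀' hK]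
    exact h v hv
  rwa [div_le_iff₀' hK] at this

/-- The set of lengths of chains in `H^M`. -/
def chainSet (P : LagVar → Prop) (Xa Xb : LagVar) : Set ℝ :=
  {v : ℝ | ∃ N : ℕ, 1 ≤ N ∧ ∃ Z : ℕ → LagVar,
    (∀ n, n ≤ N → P (Z n)) ∧ Z 0 = Xa ∧ Z N = Xb ∧
    v = ∑ n ∈ Finset.range N, Jfun (Z n) (Z (n+1))}

theorem chainSet_nonneg {P : LagVar → Prop} {Xa Xb : LagVar} : ∀ v ∈ chainSet P Xa Xb, 0 ≤ v := by
  rintro v ⟨N, -, Z, -, -, -, rfl⟩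
  exact Finset.sum_nonneg fun n _ => Jfun_nonneg _ _

theorem chainSet_bdd {P : LagVar → Prop} {Xa Xb : LagVar} : BddBelow (chainSet P Xa Xb) :=
  ⟨0, fun v hv => chainSet_nonneg v hv⟩

theorem chainSet_one {P : LagVar → Prop} {Xa Xb : LagVar} (ha : P Xa) (hb : P Xb) :
    Jfun Xa Xb ∈ chainSet P Xa Xb := by
  refine ⟨1, le_rfl, fun n => if n = 0 then Xa else Xb, ?_, by simp, by simp, by simp⟩
  intro n _
  by_cases h : n = 0 <;> simp [h, ha, hb]

theorem chainSet_symm {P : LagVar → Prop} {Xa Xb : LagVar} {v : ℝ}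
    (h : v ∈ chainSet P Xa Xb) : v ∈ chainSet P Xb Xa := by
  obtain ⟨N, hN, Z, hZ, h0, h1, rfl⟩ := h
  refine ⟨N, hN, fun n => Z (N - n), fun n _ => hZ _ (Nat.sub_le _ _), by simpa using h1,
    by simpa using h0, ?_⟩
  rw [← Finset.sum_range_reflect]
  apply Finset.sum_congr rfl
  intro n hn
  have hn' := Finset.mem_range.1 hn
  have e1 : N - 1 - n = N - (n + 1) := by omega
  have e2 : N - 1 - n + 1 = N - n := by omega
  rw [e2, e1, Jfun_comm]

theorem chainSet_add {P : LagVar → Prop} {Xa Xb Xc : LagVar} {v w : ℝ}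
    (h : v ∈ chainSet P Xa Xb) (h' : w ∈ chainSet P Xb Xc) : v + w ∈ chainSet P Xa Xc := by
  obtain ⟨N, hN, Z, hZ, h0, h1, rfl⟩ := h
  obtain ⟨N', hN', Z', hZ', h0', h1', rfl⟩ := h'
  refine ⟨N + N', by omega, fun n => if n ≤ N then Z n else Z' (n - N), ?_, by simpa using h0, ?_, ?_⟩
  · intro n hn
    by_cases h : n ≤ N
    · simpa [h] using hZ n h
    · simpa [h] using hZ' (n - N) (by omega)
  · have : ¬ (N + N' ≤ N) := by omega
    simp [this, h1']
  · rw [Finset.sum_range_add]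
    congr 1
    · apply Finset.sum_congr rfl
      intro n hn
      have hn' := Finset.mem_range.1 hn
      have e1 : n ≤ N := by omega
      have e2 : n + 1 ≤ N := by omega
      simp [e1, e2]
    · apply Finset.sum_congr rfl
      intro n hn
      have e2 : ¬ (N + n + 1 ≤ N) := by omega
      have e3 : N + n + 1 - N = n + 1 := by omega
      simp only [e2, e3, if_false]
      by_cases hn0 : n = 0
      · subst hn0
        simp [h0', h1]
      · have e4 : ¬ (N + n ≤ N) := by omega
        have e5 : N + n - N = n := by omega
        simp only [e4, e5, if_false]

theorem chain_bound {M K : ℝ} (hK : 0 < K) (Φ : LagVar → ℝ)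
    (h : ∀ Xa Xb, InHM M Xa → InHM M Xb → ∀ f g, InG f → InG g →
      |Φ Xa - Φ Xb| ≤ K * Edist (act Xa f) (act Xb g))
    {Xa Xb : LagVar} (ha : InHM M Xa) (hb : InHM M Xb) : |Φ Xa - Φ Xb| ≤ K * dM M Xa Xb := by
  have hJ : ∀ Xa Xb, InHM M Xa → InHM M Xb → |Φ Xa - Φ Xb| ≤ K * Jfun Xa Xb := by
    intro Xa Xb ha hb
    unfold Jfun
    refine le_mul_sInf (S := {v : ℝ | ∃ f g : Relabel, InG f ∧ InG g ∧
      v = Edist (act Xa f) (act Xb g)}) (Set.nonempty_of_mem (x := Edist (act Xa idR) (act Xb idR))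
      ⟨idR, idR, inG_idR, inG_idR, rfl⟩) hK ?_
    rintro v ⟨f, g, hf, hg, rfl⟩
    exact h Xa Xb ha hb f g hf hg
  apply le_mul_sInf (S := chainSet (InHM M) Xa Xb) ⟨_, chainSet_one ha hb⟩ hK
  rintro v ⟨N, -, Z, hZ, rfl, rfl, rfl⟩
  rw [Finset.mul_sum]
  have e : Φ (Z 0) - Φ (Z N) = ∑ n ∈ Finset.range N, (Φ (Z n) - Φ (Z (n+1))) := by
    rw [Finset.sum_range_sub']
  rw [e]
  refine (Finset.abs_sum_le_sum_abs _ _).trans (Finset.sum_le_sum fun n hn => ?_)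
  have hn' := Finset.mem_range.1 hn
  exact hJ _ _ (hZ _ (by omega)) (hZ _ (by omega))

theorem dM_bounds {M : ℝ} (hM : 0 < M) {Xa Xb : LagVar} (ha : InHM M Xa) (hb : InHM M Xb) :
    (∀ x, |Xa.y x - Xb.y x| ≤ (20 * (1 + M)^2) * dM M Xa Xb) ∧
    (∀ x, |Xa.U x - Xb.U x| ≤ (20 * (1 + M)^2) * dM M Xa Xb) ∧
    (∀ a b, a ≤ b → b ≤ a + 1 →
      |(∫ x in a..b, Xa.ν x) - ∫ x in a..b, Xb.ν x| ≤ (20 * (1 + M)^2) * dM M Xa Xb) ∧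
    (∀ a b, a ≤ b → b ≤ a + 1 →
      |(∫ x in a..b, Xa.r x) - ∫ x in a..b, Xb.r x| ≤ (20 * (1 + M)^2) * dM M Xa Xb) := by
  have hK : 0 < 20 * (1 + M)^2 := by positivity
  refine ⟨fun x => ?_, fun x => ?_, fun a b h1 h2 => ?_, fun a b h1 h2 => ?_⟩
  · exact chain_bound hK (fun X => X.y x)
      (fun Xa Xb ha hb f g hf hg => (onestep ha hb hf hg rfl).1 x) ha hb
  · exact chain_bound hK (fun X => X.U x)
      (fun Xa Xb ha hb f g hf hg => (onestep ha hb hf hg rfl).2.1 x) ha hb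
  · exact chain_bound hK (fun X => ∫ x in a..b, X.ν x)
      (fun Xa Xb ha hb f g hf hg => (onestep ha hb hf hg rfl).2.2.1 a b h1 h2) ha hb
  · exact chain_bound hK (fun X => ∫ x in a..b, X.r x)
      (fun Xa Xb ha hb f g hf hg => (onestep ha hb hf hg rfl).2.2.2 a b h1 h2) ha hb

theorem L1_zero {p q : ℝ → ℝ} (hp : IntervalIntegrable p volume 0 1)
    (hq : IntervalIntegrable q volume 0 1)
    (h : ∀ x, 0 ≤ x → x ≤ 1 → (∫ t in (0:ℝ)..x, p t) = ∫ t in (0:ℝ)..x, q t) :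
    L1norm01 (fun ξ => p ξ - q ξ) = 0 := by
  unfold L1norm01
  have h1 : ∀ᵐ x ∂(volume : Measure ℝ), x ≠ 1 := by simp [ae_iff, measure_singleton]
  rw [intervalIntegral.integral_congr_ae (g := fun _ => (0:ℝ))]
  · simp
  · filter_upwards [(hp.sub hq).ae_hasDerivAt_integral, h1] with x hx hx1 hxI
    rw [uIoc_of_le zero_le_one] at hxI
    rw [uIcc_of_le zero_le_one] at hx
    have hd := hx ⟨hxI.1.le, hxI.2⟩ 0 ⟨le_rfl, zero_le_one⟩
    have hd0 : HasDerivAt (fun x => ∫ t in (0:ℝ)..x, (p - q) t) 0 x := by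
      refine (hasDerivAt_const x (0:ℝ)).congr_of_eventuallyEq ?_
      filter_upwards [Ioo_mem_nhds hxI.1 (lt_of_le_of_ne hxI.2 hx1)] with z hz
      have hsub : uIcc (0:ℝ) z ⊆ uIcc 0 1 := by
        rw [uIcc_of_le hz.1.le, uIcc_of_le zero_le_one]
        exact Icc_subset_Icc le_rfl hz.2.le
      have := intervalIntegral.integral_sub (hp.mono_set hsub) (hq.mono_set hsub)
      simp only [Pi.sub_apply]
      rw [this, h z hz.1.le hz.2.le, sub_self]
    have := hd.unique hd0
    show |p x - q x| = 0
    rw [this, abs_zero]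

theorem dM_eq_zero {M : ℝ} (hM : 0 < M) {Xa Xb : LagVar} (ha : InHM M Xa) (hb : InHM M Xb)
    (h0 : dM M Xa Xb = 0) : Edist Xa Xb = 0 := by
  obtain ⟨b1, b2, b3, b4⟩ := dM_bounds hM ha hb
  rw [h0, mul_zero] at b1 b2 b3 b4
  have c1 : ∀ x, Xa.y x = Xb.y x := fun x => sub_eq_zero.1 (abs_nonpos_iff.1 (b1 x))
  have c2 : ∀ x, Xa.U x = Xb.U x := fun x => sub_eq_zero.1 (abs_nonpos_iff.1 (b2 x))
  obtain ⟨-, -, -, -, -, -, -, -, Iya, IUa, iya, iUa, iνa, ira⟩ := ha.1.1.1.1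
  obtain ⟨-, -, -, -, -, -, -, -, Iyb, IUb, iyb, iUb, iνb, irb⟩ := hb.1.1.1.1
  unfold Edist W11norm
  rw [L1_zero iya iyb (fun x _ _ => by rw [← Iya, ← Iyb, c1, c1]),
    L1_zero iUa iUb (fun x _ _ => by rw [← IUa, ← IUb, c2, c2]),
    L1_zero iνa iνb (fun x h h1 => sub_eq_zero.1 (abs_nonpos_iff.1 (b3 0 x h (by linarith)))),
    L1_zero ira irb (fun x h h1 => sub_eq_zero.1 (abs_nonpos_iff.1 (b4 0 x h (by linarith))))]
  have s1 : supNorm01 (fun ξ => Xa.y ξ - Xb.y ξ) = 0 :=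
    le_antisymm (supNorm01_le b1) (supNorm01_nonneg _)
  have s2 : supNorm01 (fun ξ => Xa.U ξ - Xb.U ξ) = 0 :=
    le_antisymm (supNorm01_le b2) (supNorm01_nonneg _)
  rw [s1, s2]
  norm_num

/-- `d_M` is a metric on `H^M` (nonnegative, vanishing exactly on the diagonal — equality
understood in `E`, i.e. `E`-distance zero — symmetric, and satisfying the triangle
inequality). Moreover there is a constant `C_M` depending only on `M` such that for
`X_α, X_β ∈ H^M`, with `R = ∫₀¹ r dη` and `h = ∫₀¹ ν dη`,
`‖y_α−y_β‖_{L^∞} + ‖U_α−U_β‖_{L^∞} + |h_α−h_β| + |R_α−R_β| ≤ C_M d_M(X_α,X_β)`;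
and `d(X_α,X_β) ≤ ‖X_α−X_β‖_E` for all `X_α, X_β ∈ F`. -/
theorem dM_metric_and_bounds (M : ℝ) (hM : 0 < M) :
    (∀ Xa Xb : LagVar, InHM M Xa → InHM M Xb → 0 ≤ dM M Xa Xb) ∧
    (∀ Xa : LagVar, InHM M Xa → dM M Xa Xa = 0) ∧
    (∀ Xa Xb : LagVar, InHM M Xa → InHM M Xb → dM M Xa Xb = dM M Xb Xa) ∧
    (∀ Xa Xb : LagVar, InHM M Xa → InHM M Xb → dM M Xa Xb = 0 → Edist Xa Xb = 0) ∧
    (∀ Xa Xb Xc : LagVar, InHM M Xa → InHM M Xb → InHM M Xc →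
      dM M Xa Xc ≤ dM M Xa Xb + dM M Xb Xc) ∧
    (∃ C : ℝ, ∀ Xa Xb : LagVar, InHM M Xa → InHM M Xb →
      supNorm01 (fun ξ => Xa.y ξ - Xb.y ξ) + supNorm01 (fun ξ => Xa.U ξ - Xb.U ξ)
          + |(∫ ξ in (0:ℝ)..1, Xa.ν ξ) - ∫ ξ in (0:ℝ)..1, Xb.ν ξ|
          + |(∫ ξ in (0:ℝ)..1, Xa.r ξ) - ∫ ξ in (0:ℝ)..1, Xb.r ξ|
        ≤ C * dM M Xa Xb) ∧
    (∀ Xa Xb : LagVar, InF Xa → InF Xb → dfun Xa Xb ≤ Edist Xa Xb) := by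
  refine ⟨?_, ?_, ?_, ?_, ?_, ?_, ?_⟩
  · intro Xa Xb _ _
    exact Real.sInf_nonneg (chainSet_nonneg (P := InHM M))
  · intro Xa ha
    apply le_antisymm
    · have := csInf_le chainSet_bdd (chainSet_one (P := InHM M) ha ha)
      rw [Jfun_self] at this
      exact this
    · exact Real.sInf_nonneg (chainSet_nonneg (P := InHM M))
  · intro Xa Xb _ _
    have : chainSet (InHM M) Xa Xb = chainSet (InHM M) Xb Xa :=
      Subset.antisymm (fun v hv => chainSet_symm hv) (fun v hv => chainSet_symm hv)
    exact congrArg sInf this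
  · intro Xa Xb ha hb h
    exact dM_eq_zero hM ha hb h
  · intro Xa Xb Xc ha hb hc
    have h1 : dM M Xa Xc - dM M Xb Xc ≤ dM M Xa Xb := by
      apply le_csInf ⟨_, chainSet_one (P := InHM M) ha hb⟩
      intro v hv
      have h2 : dM M Xa Xc - v ≤ dM M Xb Xc := by
        apply le_csInf ⟨_, chainSet_one (P := InHM M) hb hc⟩
        intro w hw
        have h3 : dM M Xa Xc ≤ v + w :=
          csInf_le chainSet_bdd (chainSet_add (P := InHM M) hv hw)
        linarith
      linarith
    linarith
  · refine ⟨4 * (20 * (1 + M)^2), ?_⟩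
    intro Xa Xb ha hb
    obtain ⟨b1, b2, b3, b4⟩ := dM_bounds hM ha hb
    have s1 := supNorm01_le b1
    have s2 := supNorm01_le b2
    have s3 := b3 0 1 zero_le_one (by norm_num)
    have s4 := b4 0 1 zero_le_one (by norm_num)
    linarith
  · intro Xa Xb ha hb
    exact (csInf_le chainSet_bdd (chainSet_one (P := InF) ha hb)).trans (Jfun_le_Edist Xa Xb)
end
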